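/- arXiv:2007.09662 — 2 statements merged into one kernel-verified Lean document; each statement's English description precedes it below -/
import Mathlib

section
/- Let -1 ≤ B < A ≤ 1 with B ≠ 0, and let f belong to the Janowski starlike class ST[A,B]. Then the distance from the origin to the boundary of the image f(D) satisfies d(0, ∂f(D)) ≥ (1 - B)^{(A-B)/B}; if instead B = 0, then d(0, ∂f(D)) ≥ e^{-A}. -/
open Complex Metric Finset

noncomputable section

/-- The open unit disc in `ℂ`. -/
def unitDisc : Set ℂ := Metric.ball 0 1

/-- The Janowski starlike class `ST[A,B]`: `f` is analytic on the unit disc,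
`f(0) = 0`, `f'(0) = 1`, and `z f'(z)/f(z)` is subordinate to `(1+Az)/(1+Bz)`
(the subordination identity being required away from the removable point `0`). -/
def JanowskiST (A B : ℝ) (f : ℂ → ℂ) : Prop :=
  AnalyticOnNhd ℂ f unitDisc ∧ f 0 = 0 ∧ deriv f 0 = 1 ∧
    ∃ w : ℂ → ℂ, AnalyticOnNhd ℂ w unitDisc ∧ w 0 = 0 ∧
      (∀ z ∈ unitDisc, w z ∈ unitDisc) ∧
      ∀ z ∈ unitDisc, z ≠ 0 →
        z * deriv f z / f z = (1 + (A : ℂ) * w z) / (1 + (B : ℂ) * w z)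

/-- What we use of the Janowski class: analytic data together with pointwise bounds. -/
lemma jan_basic (A B : ℝ) (hB1 : -1 ≤ B) (hBA : B < A) (hA1 : A ≤ 1) (w : ℂ) (hw : ‖w‖ < 1) :
    1 + (B : ℂ) * w ≠ 0 ∧ 0 < ((1 + (A : ℂ) * w) / (1 + (B : ℂ) * w)).re := by
  have hAB : ∀ C : ℝ, -1 ≤ C → C ≤ 1 → 1 + (C : ℂ) * w ≠ 0 := by
    intro C h1 h2 h
    have h3 : (C : ℂ) * w = -1 := by linear_combination h
    have h4 : ‖(C : ℂ) * w‖ = 1 := by rw [h3]; simp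
    rw [norm_mul, Complex.norm_real, Real.norm_eq_abs] at h4
    have h5 : |C| ≤ 1 := abs_le.2 ⟨h1, h2⟩
    nlinarith [norm_nonneg w, abs_nonneg C]
  have hb := hAB B hB1 (by linarith)
  refine ⟨hb, ?_⟩
  have hn : 0 < Complex.normSq (1 + (B : ℂ) * w) := Complex.normSq_pos.2 hb
  have hs : w.re ^ 2 + w.im ^ 2 = ‖w‖ ^ 2 := by
    rw [← Complex.normSq_eq_norm_sq, Complex.normSq_apply]; ring
  have hu := abs_le.1 (Complex.abs_re_le_norm w)
  rw [Complex.div_re, ← add_div]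
  apply div_pos _ hn
  simp
  have hn0 := norm_nonneg w
  set s := ‖w‖
  have key : 0 < 1 + (A + B) * w.re + A * B * s ^ 2 := by
    have e1 : 0 < 1 - A * s := by nlinarith
    have e2 : 0 < 1 - B * s := by nlinarith
    have e3 : 0 < 1 + A * s := by nlinarith
    have e4 : 0 < 1 + B * s := by nlinarith
    rcases le_total 0 (A + B) with h | h
    · nlinarith [mul_pos e1 e2, mul_nonneg h (by linarith [hu.1] : 0 ≤ w.re + s)]
    · nlinarith [mul_pos e3 e4, mul_nonneg (neg_nonneg.2 h) (by linarith [hu.2] : 0 ≤ s - w.re)]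
  rw [← hs] at key
  nlinarith [key]

lemma jan_lower (A B : ℝ) (hB1 : -1 ≤ B) (hBA : B < A) (hA1 : A ≤ 1) (w : ℂ) (r : ℝ)
    (hr : r < 1) (hw : ‖w‖ ≤ r) :
    - (A - B) * r / (1 - B * r) ≤ ((1 + (A : ℂ) * w) / (1 + (B : ℂ) * w)).re - 1 := by
  have hb := (jan_basic A B hB1 hBA hA1 w (by linarith)).1
  have hn : 0 < Complex.normSq (1 + (B : ℂ) * w) := Complex.normSq_pos.2 hb
  have hs : w.re ^ 2 + w.im ^ 2 = ‖w‖ ^ 2 := by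
    rw [← Complex.normSq_eq_norm_sq, Complex.normSq_apply]; ring
  have hu := abs_le.1 (Complex.abs_re_le_norm w)
  have hn0 := norm_nonneg w
  have h1 : ((1 + (A : ℂ) * w) / (1 + (B : ℂ) * w)).re - 1
      = (A - B) * (w.re + B * ‖w‖ ^ 2) / Complex.normSq (1 + (B : ℂ) * w) := by
    rw [Complex.div_re, ← add_div, eq_div_iff hn.ne', sub_mul, div_mul_cancel₀ _ hn.ne',
      Complex.normSq_apply, ← hs]
    simp
    ring
  have hN : Complex.normSq (1 + (B : ℂ) * w) = 1 + 2 * B * w.re + B ^ 2 * ‖w‖ ^ 2 := by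
    rw [Complex.normSq_apply, ← hs]; simp; ring
  rw [h1]
  rw [hN] at hn ⊢
  set s := ‖w‖
  have hr0 : 0 < 1 - B * r := by nlinarith
  have hs0 : 0 < 1 - B * s := by nlinarith
  rw [div_le_div_iff₀ hr0 hn]
  have hc : 0 ≤ 1 + B * r := by nlinarith
  have key : 0 ≤ (1 - B * r) * (w.re + B * s ^ 2) + r * (1 + 2 * B * w.re + B ^ 2 * s ^ 2) := by
    nlinarith [mul_nonneg hc (by linarith [hu.1] : 0 ≤ w.re + s),
      mul_nonneg hs0.le (by linarith : 0 ≤ r - s)]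
  nlinarith [mul_nonneg (sub_nonneg.2 hBA.le) key]

/-- Moving the image point towards the origin strictly decreases the modulus of the preimage. -/
lemma local_shrink (f : ℂ → ℂ) (z d : ℂ) (hz : z ≠ 0) (hd : HasStrictDerivAt f d z)
    (hp : 0 < (z * d / f z).re) (U : Set ℂ) (hU : U ∈ nhds z) :
    ∀ᶠ t : ℝ in nhdsWithin 0 (Set.Ioi 0), ∃ z' ∈ U, f z' = (1 - (t : ℂ)) * f z ∧ ‖z'‖ < ‖z‖ := by
  have hd0 : d ≠ 0 := by rintro rfl; simp at hp
  have hf0 : f z ≠ 0 := by intro h; simp [h] at hp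
  set g := hd.localInverse f d z hd0 with hg
  have hgd : HasStrictDerivAt g d⁻¹ (f z) := hd.to_localInverse hd0
  have hgz : g (f z) = z := by
    have := (hd.hasStrictFDerivAt_equiv hd0).localInverse_apply_image
    exact this
  have hri : ∀ᶠ y in nhds (f z), f (g y) = y :=
    (hd.hasStrictFDerivAt_equiv hd0).eventually_right_inverse
  have hpath : HasDerivAt (fun t : ℝ => (1 - (t : ℂ)) * f z) (-f z) 0 := by
    have h1 : HasDerivAt (fun t : ℝ => (t : ℂ)) 1 0 := Complex.ofRealCLM.hasDerivAt
    simpa using (h1.const_sub 1).mul_const (f z)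
  have hgp : HasDerivAt (fun t : ℝ => g ((1 - (t : ℂ)) * f z)) (d⁻¹ * (-f z)) 0 := by
    have h2 : HasDerivAt g d⁻¹ ((fun t : ℝ => (1 - (t : ℂ)) * f z) 0) := by
      simpa using hgd.hasDerivAt
    exact h2.comp (0 : ℝ) hpath
  have hsq := hgp.norm_sq
  have hneg : 2 * inner ℝ (g ((1 - ((0:ℝ) : ℂ)) * f z)) (d⁻¹ * (-f z)) < 0 := by
    simp only [Complex.ofReal_zero, sub_zero, one_mul, hgz]
    rw [Complex.inner]
    have h3 : d⁻¹ * (-f z) * (starRingEnd ℂ) z = - ((z * d / f z)⁻¹ * (Complex.normSq z : ℂ)) := by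
      rw [← Complex.mul_conj]; field_simp
    rw [h3, Complex.neg_re, Complex.re_mul_ofReal, Complex.inv_re]
    have : 0 < Complex.normSq z := Complex.normSq_pos.2 hz
    have h4 : 0 < Complex.normSq (z * d / f z) := Complex.normSq_pos.2 (by
      intro h; rw [h] at hp; simp at hp)
    have := mul_pos (div_pos hp h4) this
    linarith
  have hlt : ∀ᶠ t : ℝ in nhdsWithin 0 (Set.Ioi 0),
      ‖g ((1 - (t : ℂ)) * f z)‖ ^ 2 < ‖z‖ ^ 2 := by
    have h5 := (hasDerivAt_iff_tendsto_slope.1 hsq).eventually_lt_const hneg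
    have h6 := h5.filter_mono (nhdsWithin_mono (0:ℝ) (fun t (ht : 0 < t) => ht.ne' :
      Set.Ioi (0:ℝ) ⊆ {0}ᶜ))
    filter_upwards [h6, self_mem_nhdsWithin] with t ht ht0
    rw [slope_def_field] at ht
    have ht0' : (0:ℝ) < t := ht0
    rw [div_lt_iff₀ (by linarith)] at ht
    simp [hgz] at ht
    linarith
  have hpt : Filter.Tendsto (fun t : ℝ => (1 - (t : ℂ)) * f z) (nhdsWithin 0 (Set.Ioi 0))
      (nhds (f z)) := by
    have := hpath.continuousAt.tendsto
    simp at this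
    exact this.mono_left nhdsWithin_le_nhds
  have hgt : Filter.Tendsto (fun t : ℝ => g ((1 - (t : ℂ)) * f z)) (nhdsWithin 0 (Set.Ioi 0))
      (nhds z) := by
    have := hgp.continuousAt.tendsto
    simp [hgz] at this
    exact this.mono_left nhdsWithin_le_nhds
  filter_upwards [hlt, hpt.eventually hri, hgt.eventually hU] with t h1 h2 h3
  exact ⟨_, h3, h2, lt_of_pow_lt_pow_left₀ 2 (norm_nonneg _) h1⟩

lemma injOn_aux (f : ℂ → ℂ) (hf : AnalyticOnNhd ℂ f unitDisc) (f0 : f 0 = 0)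
    (hd : ∀ z ∈ unitDisc, deriv f z ≠ 0)
    (hp : ∀ z ∈ unitDisc, z ≠ 0 → 0 < (z * deriv f z / f z).re) : Set.InjOn f unitDisc := by
  have hstr : ∀ z ∈ unitDisc, HasStrictDerivAt f (deriv f z) z := fun z hz =>
    (hf z hz).hasStrictDerivAt
  have hne : ∀ z ∈ unitDisc, z ≠ 0 → f z ≠ 0 := by
    intro z hz hz0 h
    have := hp z hz hz0
    simp [h] at this
  have mem : ∀ z : ℂ, z ∈ unitDisc ↔ ‖z‖ < 1 := by intro z; simp [unitDisc]
  intro a ha b hb hab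
  by_contra hne'
  set K : Set (ℂ × ℂ) := {p | ‖p‖ ≤ ‖(a, b)‖ ∧ p.1 ≠ p.2 ∧ f p.1 = f p.2} with hK
  have hm : ‖(a, b)‖ < 1 := by
    rw [Prod.norm_def]; exact max_lt ((mem a).1 ha) ((mem b).1 hb)
  have hin : ∀ p : ℂ × ℂ, ‖p‖ ≤ ‖(a, b)‖ → p.1 ∈ unitDisc ∧ p.2 ∈ unitDisc := by
    intro p h
    exact ⟨(mem _).2 (((norm_fst_le p).trans h).trans_lt hm),
      (mem _).2 (((norm_snd_le p).trans h).trans_lt hm)⟩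
  have hKc : IsClosed K := by
    refine isClosed_of_closure_subset ?_
    intro p hpc
    have h1 : ‖p‖ ≤ ‖(a, b)‖ := by
      have : closure K ⊆ {p | ‖p‖ ≤ ‖(a, b)‖} :=
        closure_minimal (fun q hq => hq.1) (isClosed_le continuous_norm continuous_const)
      exact this hpc
    have hfr := mem_closure_iff_frequently.1 hpc
    obtain ⟨hp1, hp2⟩ := hin p h1
    have t1 : Filter.Tendsto (fun q : ℂ × ℂ => q.1) (nhds p) (nhds p.1) := continuous_fst.tendsto p
    have t2 : Filter.Tendsto (fun q : ℂ × ℂ => q.2) (nhds p) (nhds p.2) := continuous_snd.tendsto p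
    refine ⟨h1, ?_, ?_⟩
    · intro heq
      set e := ((hstr _ hp1).hasStrictFDerivAt_equiv (hd _ hp1)).toOpenPartialHomeomorph f with he
      have hU : e.source ∈ nhds p.1 := e.open_source.mem_nhds
        ((hstr _ hp1).hasStrictFDerivAt_equiv (hd _ hp1)).mem_toOpenPartialHomeomorph_source
      have ev := (t1.eventually hU).and (t2.eventually (heq ▸ hU))
      obtain ⟨q, hq, hq1, hq2⟩ := (hfr.and_eventually ev).exists
      exact hq.2.1 (e.injOn hq1 hq2 hq.2.2)
    · exact tendsto_nhds_unique_of_frequently_eq ((hf _ hp1).continuousAt.tendsto.comp t1)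
        ((hf _ hp2).continuousAt.tendsto.comp t2) (hfr.mono fun q hq => hq.2.2)
  have hKcomp : IsCompact K := by
    refine (isCompact_closedBall (0 : ℂ × ℂ) ‖(a, b)‖).of_isClosed_subset hKc ?_
    intro q hq
    simpa using hq.1
  obtain ⟨p, hpK, hmin⟩ := hKcomp.exists_isMinOn ⟨(a, b), le_rfl, hne', hab⟩
    continuous_norm.continuousOn
  obtain ⟨hp1, hp2⟩ := hin p hpK.1
  have z1 : p.1 ≠ 0 := by
    intro h
    have h' : f p.2 = 0 := by rw [← hpK.2.2, h, f0]
    by_cases h2 : p.2 = 0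
    · exact hpK.2.1 (h.trans h2.symm)
    · exact hne _ hp2 h2 h'
  have z2 : p.2 ≠ 0 := by
    intro h
    have h' : f p.1 = 0 := by rw [hpK.2.2, h, f0]
    exact hne _ hp1 z1 h'
  obtain ⟨U, V, hUo, hVo, hpU, hpV, hUV⟩ := t2_separation hpK.2.1
  have e1 := local_shrink f p.1 _ z1 (hstr _ hp1) (hp _ hp1 z1) U (hUo.mem_nhds hpU)
  have e2 := local_shrink f p.2 _ z2 (hstr _ hp2) (hp _ hp2 z2) V (hVo.mem_nhds hpV)
  obtain ⟨t, ⟨u, huU, hu, hul⟩, ⟨v, hvV, hv, hvl⟩⟩ := (e1.and e2).exists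
  have hlt : ‖(u, v)‖ < ‖p‖ := by
    rw [Prod.norm_def, Prod.norm_def]
    exact max_lt_max hul hvl
  have hmem : (u, v) ∈ K := by
    refine ⟨hlt.le.trans hpK.1, ?_, ?_⟩
    · intro h
      exact Set.disjoint_left.1 hUV huU (by simpa [← (show u = v from h)] using hvV)
    · change f u = f v
      rw [hu, hv, hpK.2.2]
  exact absurd (hmin hmem) (not_le.2 hlt)

lemma image_ne_univ (f : ℂ → ℂ) (hf : AnalyticOnNhd ℂ f unitDisc)
    (hd : ∀ z ∈ unitDisc, deriv f z ≠ 0) (hinj : Set.InjOn f unitDisc) :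
    f '' unitDisc ≠ Set.univ := by
  intro h
  have hex : ∀ y, ∃ z ∈ unitDisc, f z = y := by
    intro y
    have : y ∈ f '' unitDisc := by rw [h]; trivial
    exact this
  choose g hg hfg using hex
  have hopen : IsOpen unitDisc := Metric.isOpen_ball
  have hgd : Differentiable ℂ g := by
    intro y
    have hs : HasStrictDerivAt f (deriv f (g y)) (g y) := (hf _ (hg y)).hasStrictDerivAt
    have h0 := hd _ (hg y)
    have hl : HasStrictDerivAt (hs.localInverse f _ _ h0) (deriv f (g y))⁻¹ (f (g y)) :=
      hs.to_localInverse h0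
    have hlz : hs.localInverse f _ _ h0 (f (g y)) = g y :=
      (hs.hasStrictFDerivAt_equiv h0).localInverse_apply_image
    have hri : ∀ᶠ x in nhds (f (g y)), f (hs.localInverse f _ _ h0 x) = x :=
      (hs.hasStrictFDerivAt_equiv h0).eventually_right_inverse
    have hU : ∀ᶠ x in nhds (f (g y)), hs.localInverse f _ _ h0 x ∈ unitDisc := by
      apply hl.hasDerivAt.continuousAt.tendsto.eventually
      rw [hlz]
      exact hopen.mem_nhds (hg y)
    have hev : g =ᶠ[nhds (f (g y))] hs.localInverse f _ _ h0 := by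
      filter_upwards [hri, hU] with x h1 h2
      exact hinj (hg x) h2 ((hfg x).trans h1.symm)
    have := (hl.hasDerivAt.congr_of_eventuallyEq hev).differentiableAt
    rwa [hfg y] at this
  have hb : Bornology.IsBounded (Set.range g) := by
    refine (Metric.isBounded_ball (x := (0:ℂ)) (r := 1)).subset ?_
    rintro _ ⟨y, rfl⟩
    exact hg y
  have hc := hgd.apply_eq_apply_of_bounded hb (f 0) (f (1/2))
  have m0 : (0:ℂ) ∈ unitDisc := by simp [unitDisc]
  have m1 : (1/2:ℂ) ∈ unitDisc := by simp [unitDisc]; norm_num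
  have h0 := hinj (hg (f 0)) m0 (hfg _)
  have h1 := hinj (hg (f (1/2))) m1 (hfg _)
  rw [h0, h1] at hc
  norm_num at hc

lemma growth (A B : ℝ) (hB1 : -1 ≤ B) (hBA : B < A) (hA1 : A ≤ 1)
    (f w : ℂ → ℂ) (hf : AnalyticOnNhd ℂ f unitDisc) (f0 : f 0 = 0) (f1 : deriv f 0 = 1)
    (hw : AnalyticOnNhd ℂ w unitDisc) (w0 : w 0 = 0) (hwD : ∀ z ∈ unitDisc, w z ∈ unitDisc)
    (hne : ∀ z ∈ unitDisc, z ≠ 0 → f z ≠ 0)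
    (hp : ∀ z ∈ unitDisc, z ≠ 0 →
        z * deriv f z / f z = (1 + (A : ℂ) * w z) / (1 + (B : ℂ) * w z))
    (L : ℝ → ℝ) (L0 : L 0 = 0) (hL : ∀ r ∈ Set.Icc (0:ℝ) 1, HasDerivAt L (-(A - B) / (1 - B * r)) r)
    (z : ℂ) (hz : z ∈ unitDisc) : ‖z‖ * Real.exp (L ‖z‖) ≤ ‖f z‖ := by
  have mem : ∀ z : ℂ, z ∈ unitDisc ↔ ‖z‖ < 1 := by intro z; simp [unitDisc]
  by_cases hz0 : z = 0
  · simp [hz0, f0]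
  have hopen : IsOpen unitDisc := Metric.isOpen_ball
  have m0 : (0:ℂ) ∈ unitDisc := by simp [unitDisc]
  set G := dslope f 0 with hG
  have hGd : DifferentiableOn ℂ G unitDisc :=
    (Complex.differentiableOn_dslope (hopen.mem_nhds m0)).2 hf.differentiableOn
  have hG0 : G 0 = 1 := by rw [hG, dslope_same, f1]
  have hGz : ∀ x : ℂ, x * G x = f x := by
    intro x
    have := sub_smul_dslope f 0 x
    simpa [f0] using this
  have hGne : ∀ x ∈ unitDisc, G x ≠ 0 := by
    intro x hx h
    by_cases hx0 : x = 0
    · rw [hx0, hG0] at h; exact one_ne_zero h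
    · apply hne x hx hx0; rw [← hGz, h, mul_zero]
  have hGat : ∀ x ∈ unitDisc, HasDerivAt G (deriv G x) x := fun x hx =>
    (hGd.differentiableAt (hopen.mem_nhds hx)).hasDerivAt
  have hGf : ∀ x ∈ unitDisc, x ≠ 0 → x * deriv G x / G x = x * deriv f x / f x - 1 := by
    intro x hx hx0
    have h1 : HasDerivAt (fun y => y * G y) (1 * G x + x * deriv G x) x :=
      (hasDerivAt_id x).mul (hGat x hx)
    have h2 : (fun y => y * G y) = f := funext hGz
    rw [h2] at h1
    rw [h1.deriv, ← hGz x]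
    have := hGne x hx
    field_simp
    ring
  have hws : ∀ x ∈ unitDisc, ‖w x‖ ≤ ‖x‖ := by
    intro x hx
    refine Complex.norm_le_norm_of_mapsTo_ball (R := 1) hw.differentiableOn ?_ w0 ((mem x).1 hx)
    intro y hy
    first
    | exact hwD y hy
    | exact Metric.ball_subset_closedBall (hwD y hy)
  set ζ : ℂ := z / ‖z‖ with hζ
  have hnz : (‖z‖ : ℂ) ≠ 0 := by simpa using hz0
  have hζ1 : ‖ζ‖ = 1 := by
    rw [hζ, norm_div]; simp [hz0]
  have hrζ : ∀ r : ℝ, 0 ≤ r → ‖(r : ℂ) * ζ‖ = r := by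
    intro r hr; rw [norm_mul, hζ1, Complex.norm_real, Real.norm_eq_abs, abs_of_nonneg hr, mul_one]
  have hrm : ∀ r : ℝ, 0 ≤ r → r < 1 → (r : ℂ) * ζ ∈ unitDisc := by
    intro r h0 h1; rw [mem, hrζ r h0]; exact h1
  have hφ : ∀ r : ℝ, 0 ≤ r → r < 1 → HasDerivAt (fun r : ℝ => Real.log (‖G ((r : ℂ) * ζ)‖ ^ 2) / 2)
      (ζ * deriv G (r * ζ) / G (r * ζ)).re r := by
    intro r h0 h1
    have hx := hrm r h0 h1
    have a1 : HasDerivAt (fun r : ℝ => (r : ℂ) * ζ) ζ r := by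
      have h1 : HasDerivAt (fun t : ℝ => (t : ℂ)) 1 r := Complex.ofRealCLM.hasDerivAt
      simpa using h1.mul_const ζ
    have a2 : HasDerivAt (fun r : ℝ => G ((r : ℂ) * ζ)) (deriv G (r * ζ) * ζ) r :=
      (hGat _ hx).comp r a1
    have hg0 := hGne _ hx
    have a3 := (a2.norm_sq.log (by simpa using hg0)).div_const 2
    refine a3.congr_deriv ?_
    rw [Complex.inner, ← Complex.normSq_eq_norm_sq]
    have a4 : ζ * deriv G (r * ζ) / G (r * ζ) = (deriv G (r * ζ) * ζ *
        (starRingEnd ℂ) (G (r * ζ))) / (Complex.normSq (G (r * ζ)) : ℂ) := by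
      rw [← Complex.mul_conj]
      have : (starRingEnd ℂ) (G (r * ζ)) ≠ 0 := by simpa using hg0
      rw [mul_div_mul_right _ _ this, mul_comm ζ (deriv G _)]
    rw [a4, Complex.div_ofReal_re]
    ring
  have hmono : MonotoneOn (fun r : ℝ => Real.log (‖G ((r : ℂ) * ζ)‖ ^ 2) / 2 - L r) (Set.Ico 0 1) := by
    have hder : ∀ r ∈ Set.Ico (0:ℝ) 1,
        HasDerivAt (fun r : ℝ => Real.log (‖G ((r : ℂ) * ζ)‖ ^ 2) / 2 - L r)
        ((ζ * deriv G (r * ζ) / G (r * ζ)).re - (-(A - B) / (1 - B * r))) r := fun r hr =>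
      (hφ r hr.1 hr.2).sub (hL r ⟨hr.1, hr.2.le⟩)
    refine monotoneOn_of_deriv_nonneg (convex_Ico 0 1)
      (fun r hr => (hder r hr).continuousAt.continuousWithinAt) ?_ ?_
    · intro r hr
      exact (hder r (interior_subset hr)).differentiableAt.differentiableWithinAt
    · intro r hr
      rw [(hder r (interior_subset hr)).deriv]
      rw [interior_Ico] at hr
      have hx := hrm r hr.1.le hr.2
      have hx0 : (r : ℂ) * ζ ≠ 0 := by
        rw [← norm_pos_iff, hrζ r hr.1.le]; exact hr.1
      have b1 := jan_lower A B hB1 hBA hA1 (w (r * ζ)) r hr.2 (by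
        have := hws _ hx
        rwa [hrζ r hr.1.le] at this)
      rw [← hp _ hx hx0] at b1
      have b2 : ((r:ℂ) * ζ * deriv G (r * ζ) / G (r * ζ)).re
          = r * (ζ * deriv G (r * ζ) / G (r * ζ)).re := by
        rw [← Complex.re_ofReal_mul]; congr 1; ring
      rw [hGf _ hx hx0, Complex.sub_re, Complex.one_re] at b2
      rw [b2] at b1
      have b3 : -(A - B) * r / (1 - B * r) = r * (-(A - B) / (1 - B * r)) := by ring
      rw [b3] at b1
      have := le_of_mul_le_mul_left b1 hr.1
      linarith
  have hfin := hmono (⟨le_rfl, one_pos⟩ : (0:ℝ) ∈ Set.Ico (0:ℝ) 1)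
    (⟨norm_nonneg z, (mem z).1 hz⟩ : ‖z‖ ∈ Set.Ico (0:ℝ) 1) (norm_nonneg z)
  have hzz : (‖z‖ : ℂ) * ζ = z := by rw [hζ]; field_simp
  simp only [Complex.ofReal_zero, zero_mul, hG0, L0, hzz, norm_one, one_pow, Real.log_one,
    Real.log_pow] at hfin
  have hle : L ‖z‖ ≤ Real.log ‖G z‖ := by push_cast at hfin; linarith
  rw [Real.le_log_iff_exp_le (norm_pos_iff.2 (hGne z hz))] at hle
  rw [← hGz z, norm_mul]
  exact mul_le_mul_of_nonneg_left hle (norm_nonneg z)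

lemma jan_main (A B : ℝ) (hB1 : -1 ≤ B) (hBA : B < A) (hA1 : A ≤ 1)
    (f : ℂ → ℂ) (hf : JanowskiST A B f)
    (L : ℝ → ℝ) (L0 : L 0 = 0)
    (hL : ∀ r ∈ Set.Icc (0:ℝ) 1, HasDerivAt L (-(A - B) / (1 - B * r)) r) :
    Real.exp (L 1) ≤ Metric.infDist (0 : ℂ) (frontier (f '' unitDisc)) := by
  obtain ⟨hfa, f0, f1, w, hw, w0, hwD, hp⟩ := hf
  have mem : ∀ z : ℂ, z ∈ unitDisc ↔ ‖z‖ < 1 := by intro z; simp [unitDisc]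
  have hopen : IsOpen unitDisc := Metric.isOpen_ball
  have m0 : (0:ℂ) ∈ unitDisc := by simp [unitDisc]
  have hpos : ∀ z ∈ unitDisc, z ≠ 0 → 0 < (z * deriv f z / f z).re := by
    intro z hz hz0
    rw [hp z hz hz0]
    exact (jan_basic A B hB1 hBA hA1 (w z) ((mem _).1 (hwD z hz))).2
  have hne : ∀ z ∈ unitDisc, z ≠ 0 → f z ≠ 0 := by
    intro z hz hz0 h
    have := hpos z hz hz0
    simp [h] at this
  have hd : ∀ z ∈ unitDisc, deriv f z ≠ 0 := by
    intro z hz h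
    by_cases hz0 : z = 0
    · rw [hz0, f1] at h; exact one_ne_zero h
    · have := hpos z hz hz0
      simp [h] at this
  have hinj := injOn_aux f hfa f0 hd hpos
  have huniv := image_ne_univ f hfa hd hinj
  have himo : IsOpen (f '' unitDisc) := by
    rw [isOpen_iff_mem_nhds]
    rintro _ ⟨z, hz, rfl⟩
    rw [← ((hfa z hz).hasStrictDerivAt).map_nhds_eq (hd z hz)]
    exact Filter.image_mem_map (hopen.mem_nhds hz)
  have hfn : (frontier (f '' unitDisc)).Nonempty := by
    rw [Set.nonempty_iff_ne_empty]
    intro h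
    rcases isClopen_iff.1 (isClopen_iff_frontier_eq_empty.2 h) with h | h
    · have : f 0 ∈ f '' unitDisc := ⟨0, m0, rfl⟩
      rw [h] at this
      exact this
    · exact huniv h
  rw [Metric.le_infDist hfn]
  intro p hpf
  rw [dist_zero_left]
  by_contra! hlt
  obtain ⟨q, hpq, hq⟩ := exists_between hlt
  have hcont : ContinuousAt (fun r : ℝ => r * Real.exp (L r)) 1 :=
    continuousAt_id.mul ((hL 1 ⟨zero_le_one, le_rfl⟩).continuousAt.rexp)
  have hev : ∀ᶠ r : ℝ in nhds 1, q < r * Real.exp (L r) :=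
    hcont.eventually_const_lt (by simpa using hq)
  obtain ⟨ε, hε, hball⟩ := Metric.eventually_nhds_iff.1 hev
  set r0 := 1 - min ε 1 / 2 with hr0
  have hr01 : r0 < 1 := by
    have : 0 < min ε 1 := lt_min hε one_pos
    linarith
  have hcov : f '' unitDisc ⊆ f '' (Metric.closedBall 0 r0) ∪ {y | q ≤ ‖y‖} := by
    rintro _ ⟨z, hz, rfl⟩
    by_cases hzr : ‖z‖ ≤ r0
    · left; exact ⟨z, by simpa using hzr, rfl⟩
    · right
      push Not at hzr
      have hz1 := (mem z).1 hz
      have h1 := growth A B hB1 hBA hA1 f w hfa f0 f1 hw w0 hwD hne hp L L0 hL z hz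
      have h2 : q < ‖z‖ * Real.exp (L ‖z‖) := by
        apply hball
        rw [Real.dist_eq, abs_lt]
        have : min ε 1 ≤ ε := min_le_left _ _
        constructor <;> linarith
      exact (h2.trans_le h1).le
  have hsub : Metric.closedBall (0:ℂ) r0 ⊆ unitDisc := Metric.closedBall_subset_ball hr01
  have hcl : IsClosed (f '' (Metric.closedBall 0 r0) ∪ {y : ℂ | q ≤ ‖y‖}) :=
    (((isCompact_closedBall (0:ℂ) r0).image_of_continuousOn
      (hfa.continuousOn.mono hsub)).isClosed).union (isClosed_le continuous_const continuous_norm)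
  have hpn : p ∉ f '' unitDisc := by
    rw [himo.frontier_eq] at hpf
    exact hpf.2
  rcases closure_minimal hcov hcl (frontier_subset_closure hpf) with h | h
  · exact hpn (Set.image_mono hsub h)
  · exact absurd h (not_le.2 hpq)

theorem dist_boundary_JanowskiST (A B : ℝ) (hB1 : -1 ≤ B) (hBA : B < A) (hA1 : A ≤ 1)
    (f : ℂ → ℂ) (hf : JanowskiST A B f) :
    (B ≠ 0 → (1 - B) ^ ((A - B) / B) ≤
      Metric.infDist (0 : ℂ) (frontier (f '' unitDisc))) ∧
    (B = 0 → Real.exp (-A) ≤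
      Metric.infDist (0 : ℂ) (frontier (f '' unitDisc))) := by
  constructor
  · intro hB
    have h := jan_main A B hB1 hBA hA1 f hf (fun r => (A - B) / B * Real.log (1 - B * r))
      (by simp) (by
        intro r hr
        have h0 : 0 < 1 - B * r := by nlinarith [hr.1, hr.2]
        have h1 : HasDerivAt (fun r : ℝ => 1 - B * r) (-B) r := by
          simpa using ((hasDerivAt_id r).const_mul B).const_sub 1
        refine ((h1.log h0.ne').const_mul ((A - B) / B)).congr_deriv ?_
        field_simp)
    rw [Real.rpow_def_of_pos (by linarith), mul_comm]
    simpa using h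
  · intro hB
    have h := jan_main A B hB1 hBA hA1 f hf (fun r => -A * r) (by simp) (by
        intro r hr
        subst hB
        simpa using (hasDerivAt_id r).const_mul (-A))
    simpa using h
end
end

section
/- Let f(z) = z + ∑_{n=2}^∞ a_n z^n be typically real on the unit disc D. Then every coefficient a_n is real and satisfies m_n ≤ a_n ≤ n, where m_n = min_{0 < θ < π} sin(nθ)/sin(θ). -/
open Complex Metric Finset

noncomputable section

/-- `f` is a (normalized) typically real function on the unit disc:
`f` is analytic, `f(0) = 0`, `f'(0) = 1`, and for every `z` in the disc with
`Im z ≠ 0`, `Im f(z)` and `Im z` have the same sign. -/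
def TypicallyReal (f : ℂ → ℂ) : Prop :=
  AnalyticOnNhd ℂ f unitDisc ∧ f 0 = 0 ∧ deriv f 0 = 1 ∧
    ∀ z ∈ unitDisc, z.im ≠ 0 → Real.sign (f z).im = Real.sign z.im

open Filter Topology in
lemma tr_im_zero (f : ℂ → ℂ) (a : ℕ → ℂ) (hf : TypicallyReal f)
    (ha : ∀ z ∈ unitDisc, HasSum (fun n => a n * z ^ n) (f z)) (n : ℕ) : (a n).im = 0 := by
  obtain ⟨hfa, -, -, hs⟩ := hf
  have hpos : ∀ z ∈ unitDisc, 0 < z.im → 0 < (f z).im := by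
    intro z hz h
    have h1 := hs z hz h.ne'
    rw [Real.sign_of_pos h] at h1
    by_contra hc
    rcases lt_or_eq_of_le (not_lt.mp hc) with h2 | h2
    · rw [Real.sign_of_neg h2] at h1; norm_num at h1
    · rw [h2, Real.sign_zero] at h1; norm_num at h1
  have hneg : ∀ z ∈ unitDisc, z.im < 0 → (f z).im < 0 := by
    intro z hz h
    have h1 := hs z hz h.ne
    rw [Real.sign_of_neg h] at h1
    by_contra hc
    rcases lt_or_eq_of_le (not_lt.mp hc) with h2 | h2
    · rw [Real.sign_of_pos h2] at h1; norm_num at h1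
    · rw [← h2, Real.sign_zero] at h1; norm_num at h1
  have hreal : ∀ x : ℝ, (x : ℂ) ∈ unitDisc → (f x).im = 0 := by
    intro x hx
    have hopen : IsOpen unitDisc := Metric.isOpen_ball
    have hc : ContinuousAt f x := (hfa x hx).continuousAt
    have hlin : ContinuousAt (fun t : ℝ => (x : ℂ) + t * I) 0 := by fun_prop
    have hlin' : Tendsto (fun t : ℝ => (x : ℂ) + t * I) (𝓝 0) (𝓝 (x : ℂ)) := by
      have := hlin.tendsto
      simpa using this
    have ht : Tendsto (fun t : ℝ => (f ((x : ℂ) + t * I)).im) (𝓝 0) (𝓝 (f x).im) :=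
      (Complex.continuous_im.tendsto _).comp (hc.tendsto.comp hlin')
    have hmem : ∀ᶠ t : ℝ in 𝓝 0, (x : ℂ) + t * I ∈ unitDisc :=
      hlin'.eventually (hopen.mem_nhds hx)
    apply le_antisymm
    · refine le_of_tendsto (ht.mono_left (nhdsWithin_le_nhds (s := Set.Iio 0))) ?_
      filter_upwards [nhdsWithin_le_nhds hmem, self_mem_nhdsWithin] with t h1 h2
      exact (hneg _ h1 (by simpa using h2)).le
    · refine ge_of_tendsto (ht.mono_left (nhdsWithin_le_nhds (s := Set.Ioi 0))) ?_
      filter_upwards [nhdsWithin_le_nhds hmem, self_mem_nhdsWithin] with t h1 h2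
      exact (hpos _ h1 (by simpa using h2)).le
  let p : FormalMultilinearSeries ℝ ℝ ℝ := FormalMultilinearSeries.ofScalars ℝ (fun n => (a n).im)
  have hp : HasFPowerSeriesAt (fun _ : ℝ => (0 : ℝ)) p 0 := by
    rw [hasFPowerSeriesAt_iff]
    have : ∀ᶠ z : ℝ in 𝓝 0, z ∈ Metric.ball (0 : ℝ) 1 := Metric.ball_mem_nhds _ one_pos
    filter_upwards [this] with x hx
    have hx' : (x : ℂ) ∈ unitDisc := by
      simpa [unitDisc] using hx
    have h := Complex.hasSum_im (ha x hx')
    rw [hreal x hx'] at h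
    refine Eq.mp (congrArg (fun g => HasSum g _) (funext fun k => Eq.symm ?_)) h
    rw [← Complex.ofReal_pow, Complex.im_mul_ofReal]
    simp [p, mul_comm]
  have h0 : p.coeff n = 0 := by rw [hp.eq_zero]; rfl
  simpa [p] using h0

lemma int_cos_zero (c : ℤ) (hc : c ≠ 0) : ∫ x in (0:ℝ)..Real.pi, Real.cos (c * x) = 0 := by
  have hc' : (c : ℝ) ≠ 0 := by exact_mod_cast hc
  rw [intervalIntegral.integral_comp_mul_left (fun x => Real.cos x) hc']
  simp [Real.sin_int_mul_pi]

lemma int_sin_sin (k n : ℕ) (hn : 1 ≤ n) :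
    ∫ x in (0:ℝ)..Real.pi, Real.sin (k * x) * Real.sin (n * x) =
      if k = n then Real.pi / 2 else 0 := by
  have h1 : ∀ x : ℝ, Real.sin (k * x) * Real.sin (n * x) =
      (1/2) * (Real.cos (((k:ℤ) - n : ℤ) * x) - Real.cos (((k:ℤ) + n : ℤ) * x)) := by
    intro x
    push_cast
    rw [sub_mul, add_mul, Real.cos_sub, Real.cos_add]; ring
  simp_rw [h1]
  rw [intervalIntegral.integral_const_mul, intervalIntegral.integral_sub
    (Continuous.intervalIntegrable (by fun_prop) _ _)
    (Continuous.intervalIntegrable (by fun_prop) _ _), int_cos_zero ((k:ℤ)+n) (by omega)]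
  split_ifs with h
  · subst h; simp; ring
  · rw [int_cos_zero _ (by omega)]; simp

lemma abs_sin_nat_mul_le (n : ℕ) (x : ℝ) : |Real.sin (n * x)| ≤ n * |Real.sin x| := by
  induction n with
  | zero => simp
  | succ n ih =>
    push_cast
    rw [add_mul, one_mul, Real.sin_add]
    have h1 := abs_add_le (Real.sin (n * x) * Real.cos x) (Real.cos (n * x) * Real.sin x)
    rw [abs_mul, abs_mul] at h1
    have h2 := Real.abs_cos_le_one x
    have h3 := Real.abs_cos_le_one (n * x)
    nlinarith [abs_nonneg (Real.sin x), abs_nonneg (Real.sin (n*x))]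

lemma circ_mem {r : ℝ} (hr0 : 0 < r) (hr1 : r < 1) (θ : ℝ) :
    (r : ℂ) * Complex.exp (θ * I) ∈ unitDisc := by
  simp [unitDisc, Complex.norm_exp_ofReal_mul_I, abs_of_pos hr0, hr1]

lemma tr_integral (f : ℂ → ℂ) (a : ℕ → ℂ) 
    (ha : ∀ z ∈ unitDisc, HasSum (fun n => a n * z ^ n) (f z)) (hre : ∀ n, (a n).im = 0)
    (r : ℝ) (hr0 : 0 < r) (hr1 : r < 1) (n : ℕ) (hn : 1 ≤ n) :
    ∫ θ in (0:ℝ)..Real.pi, (f (r * Complex.exp (θ * I))).im * Real.sin (n * θ) =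
      (a n).re * r ^ n * (Real.pi / 2) := by
  have hrm : (r : ℂ) ∈ unitDisc := by simpa [unitDisc, abs_of_pos hr0] using hr1
  have hsum : Summable (fun k => |(a k).re| * r ^ k) := by
    have := (ha r hrm).summable.norm
    convert this using 2 with k
    rw [norm_mul, norm_pow, Complex.norm_real, Real.norm_of_nonneg hr0.le,
      Complex.abs_re_eq_norm.mpr (hre k)]
  let F : ℕ → C(ℝ, ℝ) := fun k =>
    ⟨fun θ => (a k).re * r ^ k * (Real.sin (k * θ) * Real.sin (n * θ)), by fun_prop⟩
  have hpt : ∀ θ : ℝ, HasSum (fun k => F k θ)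
      ((f (r * Complex.exp (θ * I))).im * Real.sin (n * θ)) := by
    intro θ
    have h := (Complex.hasSum_im (ha _ (circ_mem hr0 hr1 θ))).mul_right (Real.sin (n * θ))
    refine Eq.mp (congrArg (fun g => HasSum g _) (funext fun k => Eq.symm ?_)) h
    have e1 : a k = ((a k).re : ℂ) := by
      apply Complex.ext <;> simp [hre k]
    have e2 : ((r : ℂ) * Complex.exp (θ * I)) ^ k
        = ((r ^ k : ℝ) : ℂ) * Complex.exp (((k * θ : ℝ) : ℂ) * I) := by
      rw [mul_pow, ← Complex.exp_nat_mul]; push_cast; ring_nf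
    rw [e2, e1, Complex.im_ofReal_mul, Complex.im_ofReal_mul, Complex.exp_ofReal_mul_I_im]
    simp [F]; ring
  have hI : HasSum (fun k => ∫ θ in (0:ℝ)..Real.pi, F k θ)
      (∫ θ in (0:ℝ)..Real.pi, (f (r * Complex.exp (θ * I))).im * Real.sin (n * θ)) := by
    refine intervalIntegral.hasSum_integral_of_dominated_convergence
      (fun k _ => |(a k).re| * r ^ k) ?_ ?_ ?_ ?_ ?_
    · intro k; exact (F k).continuous.aestronglyMeasurable
    · intro k
      refine Filter.Eventually.of_forall fun θ _ => ?_
      simp only [F, ContinuousMap.coe_mk, norm_mul, Real.norm_eq_abs, abs_pow, abs_of_pos hr0]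
      have h1 := Real.abs_sin_le_one (k * θ)
      have h2 := Real.abs_sin_le_one (n * θ)
      have h3 : |Real.sin (k * θ)| * |Real.sin (n * θ)| ≤ 1 :=
        mul_le_one₀ h1 (abs_nonneg _) h2
      exact mul_le_of_le_one_right (by positivity) h3
    · exact Filter.Eventually.of_forall fun θ _ => hsum
    · exact intervalIntegrable_const
    · exact Filter.Eventually.of_forall fun θ _ => hpt θ
  have hI2 : ∀ k, ∫ θ in (0:ℝ)..Real.pi, F k θ =
      if k = n then (a n).re * r ^ n * (Real.pi / 2) else 0 := by
    intro k
    simp only [F, ContinuousMap.coe_mk]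
    rw [intervalIntegral.integral_const_mul, int_sin_sin k n hn]
    split_ifs with h
    · rw [h]
    · simp
  simp_rw [hI2] at hI
  exact hI.unique (hasSum_ite_eq n _)

lemma tr_ineq (f : ℂ → ℂ) (a : ℕ → ℂ) (hf : TypicallyReal f)
    (ha : ∀ z ∈ unitDisc, HasSum (fun n => a n * z ^ n) (f z)) (ha1 : a 1 = 1)
    (n : ℕ) (hn : 1 ≤ n) (c d : ℝ)
    (h : ∀ θ ∈ Set.Ioo 0 Real.pi, 0 ≤ c * Real.sin θ + d * Real.sin (n * θ)) :
    0 ≤ c + d * (a n).re := by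
  have hre := tr_im_zero f a hf ha
  have key : ∀ r ∈ Set.Ioo (0:ℝ) 1, 0 ≤ c * r + d * ((a n).re * r ^ n) := by
    rintro r ⟨hr0, hr1⟩
    have i1 := tr_integral f a ha hre r hr0 hr1 1 le_rfl
    have i2 := tr_integral f a ha hre r hr0 hr1 n hn
    have hcont : Continuous fun θ : ℝ => (f (r * Complex.exp (θ * I))).im := by
      refine Complex.continuous_im.comp ?_
      have : ContinuousOn f unitDisc := hf.1.continuousOn
      exact this.comp_continuous (by fun_prop) (circ_mem hr0 hr1)
    have hnn : 0 ≤ ∫ θ in (0:ℝ)..Real.pi, (c * ((f (r * Complex.exp (θ * I))).im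
        * Real.sin ((1:ℕ) * θ)) +
        d * ((f (r * Complex.exp (θ * I))).im * Real.sin (n * θ))) := by
      refine intervalIntegral.integral_nonneg_of_ae_restrict Real.pi_pos.le ?_
      rw [MeasureTheory.restrict_Ioo_eq_restrict_Icc.symm]
      refine (MeasureTheory.ae_restrict_mem measurableSet_Ioo).mono fun θ hθ => ?_
      have hs := Real.sin_pos_of_pos_of_lt_pi hθ.1 hθ.2
      have him : 0 < ((r : ℂ) * Complex.exp (θ * I)).im := by
        rw [Complex.im_ofReal_mul, Complex.exp_ofReal_mul_I_im]; positivity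
      have h1 := hf.2.2.2 _ (circ_mem hr0 hr1 θ) him.ne'
      rw [Real.sign_of_pos him] at h1
      have hv : 0 ≤ (f (r * Complex.exp (θ * I))).im := by
        by_contra hc
        rw [Real.sign_of_neg (not_le.mp hc)] at h1; norm_num at h1
      have := mul_nonneg hv (h θ hθ)
      simp only [Pi.zero_apply, Nat.cast_one, one_mul]
      linarith
    rw [intervalIntegral.integral_add (Continuous.intervalIntegrable (by fun_prop) _ _)
      (Continuous.intervalIntegrable (by fun_prop) _ _), intervalIntegral.integral_const_mul,
      intervalIntegral.integral_const_mul, i1, i2, ha1] at hnn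
    simp only [Complex.one_re, pow_one, one_mul] at hnn
    have hpi : 0 < Real.pi / 2 := by positivity
    refine nonneg_of_mul_nonneg_left (b := Real.pi / 2) ?_ hpi
    linarith
  have hc : Continuous fun r : ℝ => c * r + d * ((a n).re * r ^ n) := by fun_prop
  have ht := (hc.tendsto 1).mono_left (nhdsWithin_le_nhds (s := Set.Iio 1))
  simp only [mul_one, one_pow] at ht
  refine ge_of_tendsto ht ?_
  filter_upwards [Ioo_mem_nhdsLT (zero_lt_one' ℝ)] with r hr using key r hr

theorem coeff_bound_typicallyReal (f : ℂ → ℂ) (a : ℕ → ℂ)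
    (hf : TypicallyReal f)
    (ha : ∀ z ∈ unitDisc, HasSum (fun n => a n * z ^ n) (f z))
    (ha0 : a 0 = 0) (ha1 : a 1 = 1) :
    ∀ n : ℕ, 2 ≤ n → (a n).im = 0 ∧
      sInf ((fun θ : ℝ => Real.sin (n * θ) / Real.sin θ) '' Set.Ioo 0 Real.pi) ≤ (a n).re ∧
      (a n).re ≤ (n : ℝ) := by
  intro n hn
  refine ⟨tr_im_zero f a hf ha n, ?_, ?_⟩
  · set m := sInf ((fun θ : ℝ => Real.sin (n * θ) / Real.sin θ) '' Set.Ioo 0 Real.pi) with hm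
    have := tr_ineq f a hf ha ha1 n (by omega) (-m) 1 ?_
    · linarith
    intro θ hθ
    have hs := Real.sin_pos_of_pos_of_lt_pi hθ.1 hθ.2
    have hb : BddBelow ((fun θ : ℝ => Real.sin (n * θ) / Real.sin θ) '' Set.Ioo 0 Real.pi) := by
      refine ⟨-n, ?_⟩
      rintro _ ⟨t, ht, rfl⟩
      have hs := Real.sin_pos_of_pos_of_lt_pi ht.1 ht.2
      have h1 := abs_sin_nat_mul_le n t
      rw [abs_of_pos hs] at h1
      simp only
      rw [le_div_iff₀ hs]
      linarith [neg_abs_le (Real.sin (n * t))]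
    have h2 : m ≤ Real.sin (n * θ) / Real.sin θ := csInf_le hb ⟨θ, hθ, rfl⟩
    rw [le_div_iff₀ hs] at h2
    linarith
  · have := tr_ineq f a hf ha ha1 n (by omega) n (-1) ?_
    · linarith
    intro θ hθ
    have hs := Real.sin_pos_of_pos_of_lt_pi hθ.1 hθ.2
    have h1 := abs_sin_nat_mul_le n θ
    rw [abs_of_pos hs] at h1
    linarith [le_abs_self (Real.sin (n * θ))]
end
end
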